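/- There is a constant C > 0 such that for every smooth function u defined on {(t,x) : t ≥ 2} and supported in {(t,x) : |x| < t − 1}, every s ≥ 2, and every (t,x) ∈ H_s, one has s · t^{1/2} |u(t,x)| ≤ C Σ_{|J| ≤ 2} ‖(s/t) L^J u‖_{L²_f(H_s)}, where on H_s the weight s/t denotes the function √(t²−r²)/t, and the sum runs over all compositions L^J of at most 2 Lorentz boosts L_a. -/

import Mathlib

open MeasureTheory Real
noncomputable section

def pder (α : Fin 4) (φ : (Fin 4 → ℝ) → ℝ) (y : Fin 4 → ℝ) : ℝ :=
  fderiv ℝ φ y (Pi.single α 1)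

def Lb (a : Fin 3) (φ : (Fin 4 → ℝ) → ℝ) (y : Fin 4 → ℝ) : ℝ :=
  y a.succ * pder 0 φ y + y 0 * pder a.succ φ y

def rotVF (a b : Fin 3) (φ : (Fin 4 → ℝ) → ℝ) (y : Fin 4 → ℝ) : ℝ :=
  y a.succ * pder b.succ φ y - y b.succ * pder a.succ φ y

def Box (φ : (Fin 4 → ℝ) → ℝ) (y : Fin 4 → ℝ) : ℝ :=
  - pder 0 (pder 0 φ) y + ∑ a : Fin 3, pder a.succ (pder a.succ φ) y

inductive VF : Type
  | pd : Fin 4 → VF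
  | boost : Fin 3 → VF
  | rot : Fin 3 → Fin 3 → VF
  deriving DecidableEq, Fintype

def VF.apply : VF → ((Fin 4 → ℝ) → ℝ) → ((Fin 4 → ℝ) → ℝ)
  | .pd α, φ => pder α φ
  | .boost a, φ => Lb a φ
  | .rot a b, φ => rotVF a b φ

def applyComp {n : ℕ} (Γ : Fin n → VF) (φ : (Fin 4 → ℝ) → ℝ) : (Fin 4 → ℝ) → ℝ :=
  (List.ofFn Γ).foldr VF.apply φ

def spt (t : ℝ) (x : Fin 3 → ℝ) : Fin 4 → ℝ := Fin.cons t x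
def rad (x : Fin 3 → ℝ) : ℝ := Real.sqrt (∑ i, x i ^ 2)
def L2normSq (g : (Fin 3 → ℝ) → ℝ) : ℝ := ∫ x : Fin 3 → ℝ, g x ^ 2
def L2norm (g : (Fin 3 → ℝ) → ℝ) : ℝ := Real.sqrt (L2normSq g)

def pderx (a : Fin 3) (g : (Fin 3 → ℝ) → ℝ) (x : Fin 3 → ℝ) : ℝ :=
  fderiv ℝ g x (Pi.single a 1)
def pderxIter (k : Fin 3 → ℕ) (g : (Fin 3 → ℝ) → ℝ) : (Fin 3 → ℝ) → ℝ :=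
  (pderx 0)^[k 0] ((pderx 1)^[k 1] ((pderx 2)^[k 2] g))
def sobNormSq (N : ℕ) (g : (Fin 3 → ℝ) → ℝ) : ℝ :=
  ∑ k ∈ Finset.univ.filter (fun k : Fin 3 → Fin (N+1) => ∑ i, (k i : ℕ) ≤ N),
    L2normSq (pderxIter (fun i => (k i : ℕ)) g)
def sobNorm (N : ℕ) (g : (Fin 3 → ℝ) → ℝ) : ℝ := Real.sqrt (sobNormSq N g)

def hypPoint (s : ℝ) (x : Fin 3 → ℝ) : Fin 4 → ℝ := spt (Real.sqrt (s^2 + ∑ i, x i ^ 2)) x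
def hypL2Sq (s : ℝ) (φ : (Fin 4 → ℝ) → ℝ) : ℝ := ∫ x : Fin 3 → ℝ, (φ (hypPoint s x))^2
def hypEnergy (μ s : ℝ) (φ : (Fin 4 → ℝ) → ℝ) : ℝ :=
  ∫ x : Fin 3 → ℝ,
    ((pder 0 φ (hypPoint s x))^2 + ∑ a : Fin 3, (pder a.succ φ (hypPoint s x))^2
      + 2 * ∑ a : Fin 3, (x a / hypPoint s x 0) * pder 0 φ (hypPoint s x) * pder a.succ φ (hypPoint s x)
      + μ^2 * (φ (hypPoint s x))^2)

def flatEnergy (μ t : ℝ) (φ : (Fin 4 → ℝ) → ℝ) : ℝ :=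
  (∑ α : Fin 4, L2normSq (fun x => pder α φ (spt t x))) + μ^2 * L2normSq (fun x => φ (spt t x))

def Xnorm (N : ℕ) (δ m : ℝ) (φ ψ : (Fin 4 → ℝ) → ℝ) : ℝ :=
  (⨆ t : {t : ℝ // 2 ≤ t}, ∑ n ∈ Finset.range (N+1), ∑ Γs : Fin n → VF,
    (flatEnergy 1 t (applyComp Γs φ) + (t : ℝ) ^ (-δ) * flatEnergy 1 t (applyComp Γs ψ)))
  + (⨆ s : {s : ℝ // 2 ≤ s}, ∑ n ∈ Finset.range (N - 5 + 1), ∑ Γs : Fin n → VF,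
    (Real.sqrt (hypEnergy m s (applyComp Γs φ))
      + (s : ℝ) ^ (-δ) * Real.sqrt (hypEnergy 1 s (applyComp Γs ψ))))

/-- Composition of Lorentz boosts `L^J = L_{a₁} ∘ ⋯ ∘ L_{aₙ}`. -/
def applyBoosts {n : ℕ} (J : Fin n → Fin 3) (φ : (Fin 4 → ℝ) → ℝ) : (Fin 4 → ℝ) → ℝ :=
  (List.ofFn J).foldr Lb φ

/-- Second order Taylor formula at `0` with the cutoff `(1 - r)²`. -/
lemma eq_integral_of_hasDerivAt_two {g g' g'' : ℝ → ℝ} (hg : ∀ r, HasDerivAt g (g' r) r)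
    (hg' : ∀ r, HasDerivAt g' (g'' r) r) (hc : Continuous g'') :
    g 0 = ∫ r in (0:ℝ)..1, r * (2 * g r - 4 * (1 - r) * g' r + (1 - r) ^ 2 * g'' r) := by
  have cg : Continuous g := continuous_iff_continuousAt.2 fun r => (hg r).continuousAt
  have cg' : Continuous g' := continuous_iff_continuousAt.2 fun r => (hg' r).continuousAt
  have key : ∀ r ∈ Set.uIcc (0:ℝ) 1,
      HasDerivAt (fun r => r * ((1 - r) ^ 2 * g' r - 2 * (1 - r) * g r) - (1 - r) ^ 2 * g r)
        (r * (2 * g r - 4 * (1 - r) * g' r + (1 - r) ^ 2 * g'' r)) r := by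
    intro r _
    have h1 : HasDerivAt (fun r : ℝ => 1 - r) (-1) r := by
      simpa using (hasDerivAt_id r).const_sub 1
    refine (((hasDerivAt_id r).mul (((h1.pow 2).mul (hg' r)).sub
      ((h1.const_mul 2).mul (hg r)))).sub ((h1.pow 2).mul (hg r))).congr_deriv ?_
    simp
    ring
  rw [intervalIntegral.integral_eq_sub_of_hasDerivAt key
    (Continuous.intervalIntegrable (by fun_prop) _ _)]
  simp

/-- The centred cube of side length one. -/
def unitCube : Set (Fin 3 → ℝ) := Set.Icc (fun _ => -(1/2)) (fun _ => 1/2)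

lemma volume_unitCube : volume unitCube = 1 := by
  rw [unitCube, Real.volume_Icc_pi]
  norm_num

lemma isCompact_unitCube : IsCompact unitCube := isCompact_Icc

instance : IsProbabilityMeasure (volume.restrict unitCube) :=
  ⟨by simp [volume_unitCube]⟩

lemma abs_le_of_mem_unitCube {y : Fin 3 → ℝ} (hy : y ∈ unitCube) (a : Fin 3) : |y a| ≤ 1 / 2 :=
  abs_le.2 ⟨hy.1 a, hy.2 a⟩

lemma integral_unitCube_le {h : (Fin 3 → ℝ) → ℝ} (hc : Continuous h)
    (hi : Integrable fun x => h x ^ 2) (x₀ : Fin 3 → ℝ) {ρ : ℝ} (hρ : 0 < ρ) :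
    ∫ y in unitCube, |h (x₀ + ρ • y)| ≤ ρ ^ (-(3/2) : ℝ) * √(∫ x, h x ^ 2) := by
  have hi' : Integrable fun y : Fin 3 → ℝ => h (x₀ + ρ • y) ^ 2 :=
    (hi.comp_add_left x₀).comp_smul hρ.ne'
  have hs : ∫ y, h (x₀ + ρ • y) ^ 2 = (ρ ^ 3)⁻¹ * ∫ x, h x ^ 2 := by
    rw [Measure.integral_comp_smul volume (fun y : Fin 3 → ℝ => h (x₀ + y) ^ 2) ρ,
      integral_add_left_eq_self (fun y => h y ^ 2) x₀]
    simp [abs_of_pos hρ]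
  have hf : Continuous fun y => |h (x₀ + ρ • y)| := by fun_prop
  have hJ : (∫ y in unitCube, |h (x₀ + ρ • y)|) ^ 2 ≤ ∫ y in unitCube, h (x₀ + ρ • y) ^ 2 := by
    have := (even_two.convexOn_pow (𝕜 := ℝ)).map_integral_le (μ := volume.restrict unitCube)
      (f := fun y => |h (x₀ + ρ • y)|) (by fun_prop) isClosed_univ (by simp)
      (hf.continuousOn.integrableOn_compact isCompact_unitCube)
      ((hf.pow 2).continuousOn.integrableOn_compact isCompact_unitCube)
    simpa using this
  have hle : ∫ y in unitCube, h (x₀ + ρ • y) ^ 2 ≤ ∫ y, h (x₀ + ρ • y) ^ 2 :=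
    setIntegral_le_integral hi' (ae_of_all _ fun y => sq_nonneg _)
  refine (Real.le_sqrt_of_sq_le (hJ.trans hle)).trans_eq ?_
  rw [hs, Real.sqrt_mul (by positivity), Real.sqrt_eq_rpow, ← Real.rpow_natCast,
    ← Real.rpow_neg hρ.le, ← Real.rpow_mul hρ.le]
  norm_num

lemma integral_unitCube_integral_le {h : (Fin 3 → ℝ) → ℝ} (hc : Continuous h)
    (hi : Integrable fun x => h x ^ 2) (x₀ : Fin 3 → ℝ) {R : ℝ} (hR : 0 < R) :
    ∫ y in unitCube, ∫ r in (0:ℝ)..1, r * |h (x₀ + r • R • y)|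
      ≤ 2 * R ^ (-(3/2) : ℝ) * √(∫ x, h x ^ 2) := by
  have hf : Continuous fun p : (Fin 3 → ℝ) × ℝ => p.2 * |h (x₀ + p.2 • R • p.1)| := by fun_prop
  have hint : Integrable (Function.uncurry fun (y : Fin 3 → ℝ) (r : ℝ) => r * |h (x₀ + r • R • y)|)
      ((volume.restrict unitCube).prod (volume.restrict (Set.Ioc (0:ℝ) 1))) := by
    rw [Measure.prod_restrict]
    exact (hf.continuousOn.integrableOn_compact (isCompact_unitCube.prod isCompact_Icc)).mono_set
      (Set.prod_mono le_rfl Set.Ioc_subset_Icc_self)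
  simp only [intervalIntegral.integral_of_le zero_le_one]
  rw [integral_integral_swap hint]
  have hpow : IntegrableOn (fun r : ℝ => r ^ (-(1/2) : ℝ)) (Set.Ioc 0 1) :=
    (intervalIntegrable_iff_integrableOn_Ioc_of_le zero_le_one).1
      (intervalIntegral.intervalIntegrable_rpow' (by norm_num))
  calc ∫ r in Set.Ioc (0:ℝ) 1, ∫ y in unitCube, r * |h (x₀ + r • R • y)|
      ≤ ∫ r in Set.Ioc (0:ℝ) 1, r ^ (-(1/2) : ℝ) * (R ^ (-(3/2) : ℝ) * √(∫ x, h x ^ 2)) := by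
        refine setIntegral_mono_on hint.integral_prod_right (hpow.mul_const _)
          measurableSet_Ioc fun r hr => ?_
        have hr0 : 0 < r := hr.1
        have := integral_unitCube_le hc hi x₀ (mul_pos hr0 hR)
        rw [integral_const_mul]
        simp only [smul_smul]
        refine (mul_le_mul_of_nonneg_left this hr0.le).trans_eq ?_
        rw [Real.mul_rpow hr0.le hR.le, ← mul_assoc, ← mul_assoc, ← mul_assoc]
        congr 2
        nth_rewrite 1 [← Real.rpow_one r]
        rw [← Real.rpow_add hr0]
        norm_num
    _ = 2 * R ^ (-(3/2) : ℝ) * √(∫ x, h x ^ 2) := by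
        rw [integral_mul_const, ← intervalIntegral.integral_of_le zero_le_one,
          integral_rpow (Or.inl (by norm_num))]
        norm_num
        ring

lemma contDiff_Lb {φ : (Fin 4 → ℝ) → ℝ} (hφ : ContDiff ℝ (⊤ : ℕ∞) φ) (a : Fin 3) :
    ContDiff ℝ (⊤ : ℕ∞) (Lb a φ) := by
  have hp : ∀ α, ContDiff ℝ (⊤ : ℕ∞) (pder α φ) := fun α =>
    (hφ.fderiv_right (m := (⊤ : ℕ∞)) (by norm_cast)).clm_apply contDiff_const
  have hy : ∀ i : Fin 4, ContDiff ℝ (⊤ : ℕ∞) fun y : Fin 4 → ℝ => y i := fun i =>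
    contDiff_apply ℝ ℝ i
  exact ((hy _).mul (hp _)).add ((hy _).mul (hp _))

lemma continuous_rad : Continuous rad := by
  unfold rad
  fun_prop

/-- The complement of the closed cone on which the boosts of `u` may be nonzero. -/
def coneExterior : Set (Fin 4 → ℝ) := {y | y 0 - 1 < rad fun i => y i.succ}

lemma isOpen_coneExterior : IsOpen coneExterior := by
  have := continuous_rad
  exact isOpen_lt (by fun_prop) (by fun_prop)

lemma eqOn_zero_Lb {φ : (Fin 4 → ℝ) → ℝ} (hφ : ∀ y ∈ coneExterior, φ y = 0) (a : Fin 3) :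
    ∀ y ∈ coneExterior, Lb a φ y = 0 := by
  intro y hy
  have h : φ =ᶠ[nhds y] fun _ => 0 :=
    Filter.eventually_of_mem (isOpen_coneExterior.mem_nhds hy) hφ
  simp [Lb, pder, h.fderiv_eq]

lemma hypPoint_zero (s : ℝ) (x : Fin 3 → ℝ) : hypPoint s x 0 = √(s ^ 2 + ∑ i, x i ^ 2) := rfl

lemma hypPoint_succ (s : ℝ) (x : Fin 3 → ℝ) (a : Fin 3) : hypPoint s x a.succ = x a := rfl

lemma hypPoint_zero_sq (s : ℝ) (x : Fin 3 → ℝ) :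
    hypPoint s x 0 ^ 2 = s ^ 2 + ∑ i, x i ^ 2 := by
  rw [hypPoint_zero, Real.sq_sqrt (by positivity)]

lemma hypPoint_zero_pos {s : ℝ} (hs : 0 < s) (x : Fin 3 → ℝ) : 0 < hypPoint s x 0 := by
  rw [hypPoint_zero]
  positivity

lemma abs_le_hypPoint_zero (s : ℝ) (x : Fin 3 → ℝ) (a : Fin 3) : |x a| ≤ hypPoint s x 0 := by
  rw [hypPoint_zero]
  refine Real.abs_le_sqrt ?_
  have := Finset.single_le_sum (f := fun i => x i ^ 2) (fun i _ => sq_nonneg _)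
    (Finset.mem_univ a)
  nlinarith [sq_nonneg s]

lemma continuous_hypPoint (s : ℝ) : Continuous (hypPoint s) := by
  refine continuous_pi fun i => ?_
  refine Fin.cases ?_ (fun a => ?_) i
  · simp only [hypPoint_zero]
    fun_prop
  · simp only [hypPoint_succ]
    fun_prop

lemma hypPoint_mem_coneExterior {s : ℝ} {x : Fin 3 → ℝ} (h : s ^ 2 < rad x) :
    hypPoint s x ∈ coneExterior := by
  change √(s ^ 2 + ∑ i, x i ^ 2) - 1 < rad x
  have h0 : rad x ^ 2 = ∑ i, x i ^ 2 := Real.sq_sqrt (by positivity)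
  rw [← h0, sub_lt_iff_lt_add, Real.sqrt_lt' (by nlinarith [sq_nonneg s])]
  nlinarith [sq_nonneg s]

lemma hasCompactSupport_comp_hypPoint {φ : (Fin 4 → ℝ) → ℝ}
    (hφ : ∀ y ∈ coneExterior, φ y = 0) (s : ℝ) :
    HasCompactSupport fun x => φ (hypPoint s x) := by
  refine HasCompactSupport.of_support_subset_isCompact
    (isCompact_closedBall (0 : Fin 3 → ℝ) (s ^ 2)) fun x hx => ?_
  rw [mem_closedBall_zero_iff]
  by_contra! hn
  refine hx (hφ _ (hypPoint_mem_coneExterior (hn.trans_le ?_)))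
  refine (pi_norm_le_iff_of_nonneg (Real.sqrt_nonneg _)).2 fun i => Real.abs_le_sqrt ?_
  exact Finset.single_le_sum (f := fun i => x i ^ 2) (fun i _ => sq_nonneg _) (Finset.mem_univ i)

lemma hasDerivAt_hypPoint_zero {s : ℝ} (hs : 0 < s) (x k : Fin 3 → ℝ) (r : ℝ) :
    HasDerivAt (fun r : ℝ => hypPoint s (x + r • k) 0)
      ((∑ a, (x + r • k) a * k a) / hypPoint s (x + r • k) 0) r := by
  have h1 : HasDerivAt (fun r : ℝ => s ^ 2 + ∑ i, (x + r • k) i ^ 2)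
      (2 * ∑ a, (x + r • k) a * k a) r := by
    rw [Finset.mul_sum]
    refine (HasDerivAt.fun_sum fun i _ => ?_).const_add _
    have : HasDerivAt (fun r : ℝ => (x + r • k) i) (k i) r := by
      simpa using ((hasDerivAt_id r).mul_const (k i)).const_add (x i)
    refine (this.pow 2).congr_deriv ?_
    simp
    ring
  have hpos : 0 < s ^ 2 + ∑ i, (x + r • k) i ^ 2 := by positivity
  refine (h1.sqrt hpos.ne').congr_deriv ?_
  rw [hypPoint_zero, mul_div_mul_left _ _ two_ne_zero]

/-- The boosts are the derivatives tangent to the hyperboloids, up to the factor `t`. -/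
lemma hasDerivAt_comp_hypPoint {φ : (Fin 4 → ℝ) → ℝ} (hφ : Differentiable ℝ φ) {s : ℝ}
    (hs : 0 < s) (x k : Fin 3 → ℝ) (r : ℝ) :
    HasDerivAt (fun r : ℝ => φ (hypPoint s (x + r • k)))
      (∑ a, k a * (Lb a φ (hypPoint s (x + r • k)) / hypPoint s (x + r • k) 0)) r := by
  have hcurve : HasDerivAt (fun r : ℝ => hypPoint s (x + r • k))
      (spt ((∑ a, (x + r • k) a * k a) / hypPoint s (x + r • k) 0) k) r := by
    refine hasDerivAt_pi.2 fun i => ?_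
    refine Fin.cases (hasDerivAt_hypPoint_zero hs x k r) (fun a => ?_) i
    change HasDerivAt (fun r : ℝ => x a + r * k a) (k a) r
    simpa using ((hasDerivAt_id r).mul_const (k a)).const_add (x a)
  refine ((hφ (hypPoint s (x + r • k))).hasFDerivAt.comp_hasDerivAt r hcurve).congr_deriv ?_
  have ht := (hypPoint_zero_pos hs (x + r • k)).ne'
  have hsum : ∀ (w : ℝ), spt w k
      = w • Pi.single 0 1 + ∑ a : Fin 3, k a • Pi.single a.succ 1 := by
    intro w
    ext i
    fin_cases i <;> simp [spt, Fin.sum_univ_three] <;> rfl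
  rw [hsum, map_add, map_sum, map_smul]
  simp only [map_smul, smul_eq_mul, Lb, hypPoint_succ]
  rw [Finset.sum_div, Finset.sum_mul, ← Finset.sum_add_distrib]
  refine Finset.sum_congr rfl fun a _ => ?_
  simp only [pder]
  field_simp

/-- The restriction of `(s/t) φ` to the hyperboloid `H_s`, as a function of `x`. -/
def hypWeighted (s : ℝ) (φ : (Fin 4 → ℝ) → ℝ) (x : Fin 3 → ℝ) : ℝ :=
  s / hypPoint s x 0 * φ (hypPoint s x)

/-- The sum of `F (L^J u)` over all compositions `L^J` of at most two boosts. -/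
def boostSum (F : ((Fin 4 → ℝ) → ℝ) → ℝ) (u : (Fin 4 → ℝ) → ℝ) : ℝ :=
  ∑ n ∈ Finset.range 3, ∑ J : Fin n → Fin 3, F (applyBoosts J u)

lemma boostSum_eq (F : ((Fin 4 → ℝ) → ℝ) → ℝ) (u : (Fin 4 → ℝ) → ℝ) :
    boostSum F u = F u + ∑ a, F (Lb a u) + ∑ a, ∑ b, F (Lb b (Lb a u)) := by
  have h2 : ∑ J : Fin 2 → Fin 3, F (applyBoosts J u) = ∑ a, ∑ b, F (Lb b (Lb a u)) := by
    rw [Finset.sum_comm, ← Fintype.sum_prod_type' fun b a => F (Lb b (Lb a u))]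
    exact Fintype.sum_equiv (finTwoArrowEquiv _) _ _ fun J => by
      simp [applyBoosts, List.ofFn_succ]
  have h1 : ∑ J : Fin 1 → Fin 3, F (applyBoosts J u) = ∑ a, F (Lb a u) :=
    Fintype.sum_equiv (Equiv.funUnique _ _) _ _ fun J => by
      simp [applyBoosts, List.ofFn_succ]
  have h0 : ∑ J : Fin 0 → Fin 3, F (applyBoosts J u) = F u := by
    simp [applyBoosts]
  rw [boostSum, Finset.sum_range_succ, Finset.sum_range_succ, Finset.sum_range_one, h0, h1, h2]

lemma contDiff_applyBoosts {u : (Fin 4 → ℝ) → ℝ} (hu : ContDiff ℝ (⊤ : ℕ∞) u) {n : ℕ}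
    (J : Fin n → Fin 3) : ContDiff ℝ (⊤ : ℕ∞) (applyBoosts J u) := by
  unfold applyBoosts
  induction List.ofFn J with
  | nil => exact hu
  | cons a l ih => exact contDiff_Lb ih a

lemma eqOn_zero_applyBoosts {u : (Fin 4 → ℝ) → ℝ} (hu : ∀ y ∈ coneExterior, u y = 0) {n : ℕ}
    (J : Fin n → Fin 3) : ∀ y ∈ coneExterior, applyBoosts J u y = 0 := by
  unfold applyBoosts
  induction List.ofFn J with
  | nil => exact hu
  | cons a l ih => exact eqOn_zero_Lb ih a

lemma continuous_hypWeighted {s : ℝ} (hs : 0 < s) {φ : (Fin 4 → ℝ) → ℝ} (hφ : Continuous φ) :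
    Continuous (hypWeighted s φ) := by
  have h := continuous_hypPoint s
  exact (continuous_const.div (by fun_prop) fun x => (hypPoint_zero_pos hs x).ne').mul
    (hφ.comp h)

lemma integrable_hypWeighted_sq {s : ℝ} (hs : 0 < s) {φ : (Fin 4 → ℝ) → ℝ} (hφ : Continuous φ)
    (h0 : ∀ y ∈ coneExterior, φ y = 0) : Integrable fun x => hypWeighted s φ x ^ 2 := by
  refine ((continuous_hypWeighted hs hφ).pow 2).integrable_of_hasCompactSupport ?_
  refine (hasCompactSupport_comp_hypPoint h0 s).mono fun x hx => ?_
  contrapose! hx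
  simp only [Function.mem_support, not_not] at hx
  simp [hypWeighted, hx]

/-- The time coordinate is comparable at nearby points of a hyperboloid. -/
lemma hypPoint_zero_comparable {s : ℝ} (hs : 0 < s) (x k : Fin 3 → ℝ)
    (hk : ∀ a, |k a| ≤ hypPoint s x 0 / 8) :
    hypPoint s x 0 / 2 ≤ hypPoint s (x + k) 0 ∧
      hypPoint s (x + k) 0 ≤ 3 / 2 * hypPoint s x 0 := by
  have ht := hypPoint_zero_pos hs x
  have h0 := hypPoint_zero_sq s x
  have h1 := hypPoint_zero_sq s (x + k)
  set t := hypPoint s x 0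
  have hxk : ∀ a, |x a * k a| ≤ t * (t / 8) := fun a => by
    rw [abs_mul]
    exact mul_le_mul (abs_le_hypPoint_zero s x a) (hk a) (abs_nonneg _) ht.le
  have hkk : ∀ a, k a ^ 2 ≤ (t / 8) ^ 2 := fun a => sq_le_sq' (abs_le.1 (hk a)).1 (abs_le.1 (hk a)).2
  simp only [Fin.sum_univ_three, Pi.add_apply] at h0 h1
  have a0 := abs_le.1 (hxk 0)
  have a1 := abs_le.1 (hxk 1)
  have a2 := abs_le.1 (hxk 2)
  have b0 := hkk 0
  have b1 := hkk 1
  have b2 := hkk 2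
  have ht' := (hypPoint_zero_pos hs (x + k)).le
  constructor
  · refine (sq_le_sq₀ (by positivity) ht').1 ?_
    nlinarith [sq_nonneg (k 0), sq_nonneg (k 1), sq_nonneg (k 2)]
  · refine (sq_le_sq₀ ht' (by positivity)).1 ?_
    nlinarith [sq_nonneg t]

lemma abs_le_hypWeighted {s : ℝ} (hs : 0 < s) {t₀ : ℝ} (φ : (Fin 4 → ℝ) → ℝ) {x : Fin 3 → ℝ}
    (h : hypPoint s x 0 ≤ 3 / 2 * t₀) :
    |φ (hypPoint s x)| ≤ 3 / 2 * (t₀ / s) * |hypWeighted s φ x| := by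
  have ht := hypPoint_zero_pos hs x
  rw [hypWeighted, abs_mul, abs_of_pos (div_pos hs ht), ← mul_assoc]
  refine le_mul_of_one_le_left (abs_nonneg _) ?_
  rw [show 3 / 2 * (t₀ / s) * (s / hypPoint s x 0) = (3 / 2 * t₀) / hypPoint s x 0 by field_simp]
  rwa [one_le_div ht]

lemma abs_comp_hypPoint_le {u : (Fin 4 → ℝ) → ℝ} (hu : ContDiff ℝ (⊤ : ℕ∞) u) {s : ℝ}
    (hs : 0 < s) (x k : Fin 3 → ℝ) (hk : ∀ a, |k a| ≤ hypPoint s x 0 / 8) :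
    |u (hypPoint s x)| ≤ 9 / 2 * (hypPoint s x 0 / s) *
      boostSum (fun φ => ∫ r in (0:ℝ)..1, r * |hypWeighted s φ (x + r • k)|) u := by
  have hdiff : ∀ {φ : (Fin 4 → ℝ) → ℝ}, ContDiff ℝ (⊤ : ℕ∞) φ → Differentiable ℝ φ :=
    fun h => h.differentiable (by simp)
  set t₀ := hypPoint s x 0 with ht₀
  have ht₀pos : 0 < t₀ := hypPoint_zero_pos hs x
  let p : ℝ → Fin 4 → ℝ := fun r => hypPoint s (x + r • k)
  have hp : Continuous p := (continuous_hypPoint s).comp (by fun_prop)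
  have hp0 : ∀ r, 0 < p r 0 := fun r => hypPoint_zero_pos hs _
  let dV : ((Fin 4 → ℝ) → ℝ) → ℝ → ℝ := fun φ r => ∑ a, k a * (Lb a φ (p r) / p r 0)
  let dt : ℝ → ℝ := fun r => (∑ a, (x + r • k) a * k a) / p r 0
  have hV : ∀ {φ : (Fin 4 → ℝ) → ℝ}, ContDiff ℝ (⊤ : ℕ∞) φ →
      ∀ r, HasDerivAt (fun r => φ (p r)) (dV φ r) r := fun h r =>
    hasDerivAt_comp_hypPoint (hdiff h) hs x k r
  have hcdV : ∀ {φ : (Fin 4 → ℝ) → ℝ}, ContDiff ℝ (⊤ : ℕ∞) φ → Continuous (dV φ) := fun h =>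
    continuous_finsetSum _ fun a _ => continuous_const.mul
      (((contDiff_Lb h a).continuous.comp hp).div (by fun_prop) fun r => (hp0 r).ne')
  let g'' : ℝ → ℝ := fun r =>
    ∑ a, k a * ((dV (Lb a u) r * p r 0 - Lb a u (p r) * dt r) / p r 0 ^ 2)
  have hdV : ∀ r, HasDerivAt (dV u) (g'' r) r := fun r =>
    HasDerivAt.fun_sum fun a _ => ((hV (contDiff_Lb hu a) r).div
      (hasDerivAt_hypPoint_zero hs x k r) (hp0 r).ne').const_mul (k a)
  have hcdt : Continuous dt := Continuous.div (by fun_prop) (by fun_prop) fun r => (hp0 r).ne'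
  have hcg'' : Continuous g'' := continuous_finsetSum _ fun a _ => continuous_const.mul
    ((((hcdV (contDiff_Lb hu a)).mul (by fun_prop)).sub
      (((contDiff_Lb hu a).continuous.comp hp).mul hcdt)).div (by fun_prop)
      fun r => (pow_pos (hp0 r) 2).ne')
  have hw : ∀ {φ : (Fin 4 → ℝ) → ℝ}, ContDiff ℝ (⊤ : ℕ∞) φ →
      Continuous fun r : ℝ => r * |hypWeighted s φ (x + r • k)| := fun h => by
    have := continuous_hypWeighted hs h.continuous
    fun_prop
  have hswap : boostSum (fun φ => ∫ r in (0:ℝ)..1, r * |hypWeighted s φ (x + r • k)|) u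
      = ∫ r in (0:ℝ)..1, boostSum (fun φ => r * |hypWeighted s φ (x + r • k)|) u := by
    unfold boostSum
    rw [intervalIntegral.integral_finsetSum]
    · refine Finset.sum_congr rfl fun n _ => ?_
      rw [intervalIntegral.integral_finsetSum]
      exact fun J _ => (hw (contDiff_applyBoosts hu J)).intervalIntegrable _ _
    · exact fun n _ => (continuous_finsetSum _ fun J _ =>
        hw (contDiff_applyBoosts hu J)).intervalIntegrable _ _
  have hcsum : Continuous fun r : ℝ => boostSum (fun φ => r * |hypWeighted s φ (x + r • k)|) u :=
    continuous_finsetSum _ fun n _ => continuous_finsetSum _ fun J _ =>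
      hw (contDiff_applyBoosts hu J)
  have hrep := eq_integral_of_hasDerivAt_two (hV hu) hdV hcg''
  have hu0 : u (p 0) = u (hypPoint s x) := by simp [p]
  rw [hu0] at hrep
  rw [hrep, hswap, ← intervalIntegral.integral_const_mul, ← Real.norm_eq_abs]
  refine intervalIntegral.norm_integral_le_of_norm_le zero_le_one ?_
    ((hcsum.const_mul _).intervalIntegrable _ _)
  refine ae_of_all _ fun r hr => ?_
  have hr0 : 0 ≤ r := hr.1.le
  have hrk : ∀ a, |(r • k) a| ≤ t₀ / 8 := fun a => by
    rw [Pi.smul_apply, smul_eq_mul, abs_mul, abs_of_nonneg hr0]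
    exact (mul_le_of_le_one_left (abs_nonneg _) hr.2).trans (hk a)
  obtain ⟨hlo, hup⟩ := hypPoint_zero_comparable hs x (r • k) hrk
  rw [← ht₀] at hlo hup
  have hlo' : t₀ / 2 ≤ p r 0 := hlo
  have hkt : ∀ a, |k a| ≤ p r 0 / 4 := fun a => (hk a).trans (by linarith)
  have htr := hp0 r
  have hdV_le : ∀ φ, |dV φ r| ≤ ∑ a, 1 / 4 * |Lb a φ (p r)| := fun φ => by
    refine (Finset.abs_sum_le_sum_abs _ _).trans (Finset.sum_le_sum fun a _ => ?_)
    rw [abs_mul, abs_div, abs_of_pos htr, mul_div_left_comm, mul_comm]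
    refine mul_le_mul_of_nonneg_right ?_ (abs_nonneg _)
    rw [div_le_iff₀ htr]
    linarith [hkt a]
  have hdt_le : |dt r| ≤ 3 / 4 * p r 0 := by
    rw [abs_div, abs_of_pos htr, div_le_iff₀ htr]
    refine (Finset.abs_sum_le_sum_abs _ _).trans ?_
    calc ∑ a, |(x + r • k) a * k a| ≤ ∑ _a : Fin 3, p r 0 * (p r 0 / 4) :=
          Finset.sum_le_sum fun a _ => by
            rw [abs_mul]
            exact mul_le_mul (abs_le_hypPoint_zero s _ a) (hkt a) (abs_nonneg _) htr.le
      _ = 3 / 4 * p r 0 * p r 0 := by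
          simp
          ring
  have hg''_le : |g'' r| ≤
      ∑ a, (∑ b, 1 / 16 * |Lb b (Lb a u) (p r)| + 3 / 16 * |Lb a u (p r)|) := by
    refine (Finset.abs_sum_le_sum_abs _ _).trans (Finset.sum_le_sum fun a _ => ?_)
    rw [abs_mul, abs_div, abs_of_pos (pow_pos htr 2), mul_div_assoc', div_le_iff₀ (pow_pos htr 2)]
    have h1 : |dV (Lb a u) r * p r 0 - Lb a u (p r) * dt r| ≤
        (∑ b, 1 / 4 * |Lb b (Lb a u) (p r)|) * p r 0 + |Lb a u (p r)| * (3 / 4 * p r 0) := by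
      refine (abs_sub _ _).trans (add_le_add ?_ ?_)
      · rw [abs_mul, abs_of_pos htr]
        exact mul_le_mul_of_nonneg_right (hdV_le _) htr.le
      · rw [abs_mul]
        exact mul_le_mul_of_nonneg_left hdt_le (abs_nonneg _)
    refine (mul_le_mul (hkt a) h1 (abs_nonneg _) (by positivity)).trans_eq ?_
    simp only [← Finset.mul_sum]
    ring
  have hmain : |2 * u (p r) - 4 * (1 - r) * dV u r + (1 - r) ^ 2 * g'' r| ≤
      3 * boostSum (fun φ => |φ (p r)|) u := by
    have e1 : |4 * (1 - r) * dV u r| ≤ 4 * |dV u r| := by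
      rw [abs_mul]
      refine mul_le_mul_of_nonneg_right ?_ (abs_nonneg _)
      rw [abs_of_nonneg (by linarith [hr.2])]
      linarith
    have e2 : |(1 - r) ^ 2 * g'' r| ≤ |g'' r| := by
      rw [abs_mul]
      refine mul_le_of_le_one_left (abs_nonneg _) ?_
      rw [abs_of_nonneg (sq_nonneg _)]
      nlinarith [hr.2]
    have e3 : |2 * u (p r)| = 2 * |u (p r)| := by rw [abs_mul]; norm_num
    have e4 := hdV_le u
    rw [boostSum_eq]
    simp only [Finset.sum_add_distrib, ← Finset.mul_sum] at e4 hg''_le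
    have n0 := abs_nonneg (u (p r))
    have n1 : 0 ≤ ∑ a, |Lb a u (p r)| := by positivity
    have n2 : 0 ≤ ∑ a, ∑ b, |Lb b (Lb a u) (p r)| := by positivity
    refine (abs_add_le _ _).trans ((add_le_add_left (abs_sub _ _) _).trans ?_)
    linarith
  rw [Real.norm_eq_abs, abs_mul, abs_of_nonneg hr0]
  refine (mul_le_mul_of_nonneg_left hmain hr0).trans ?_
  unfold boostSum
  simp only [Finset.mul_sum]
  refine Finset.sum_le_sum fun n _ => Finset.sum_le_sum fun J _ => ?_
  have := mul_le_mul_of_nonneg_left (abs_le_hypWeighted hs (applyBoosts J u) hup) hr0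
  calc r * (3 * |applyBoosts J u (p r)|) = 3 * (r * |applyBoosts J u (p r)|) := by ring
    _ ≤ 3 * (r * (3 / 2 * (t₀ / s) * |hypWeighted s (applyBoosts J u) (x + r • k)|)) := by gcongr
    _ = _ := by ring

/-- Weighted Sobolev inequality on hyperboloids:
`s t^{1/2}|u(t,x)| ≤ C Σ_{|J|≤2} ‖(s/t) L^J u‖_{L²_f(H_s)}` on `H_s`,
for `u` supported in `{r < t-1}`; on `H_s` the weight `s/t` is `√(t²-r²)/t`. -/
theorem weighted_sobolev_on_hyperboloids :
    ∃ C : ℝ, 0 < C ∧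
      ∀ u : (Fin 4 → ℝ) → ℝ, ContDiff ℝ (⊤ : ℕ∞) u →
        (∀ t : ℝ, ∀ x : Fin 3 → ℝ, t - 1 ≤ rad x → u (spt t x) = 0) →
        ∀ s : ℝ, 2 ≤ s → ∀ x : Fin 3 → ℝ,
          s * (hypPoint s x 0) ^ ((1:ℝ)/2) * |u (hypPoint s x)|
            ≤ C * ∑ n ∈ Finset.range 3, ∑ J : Fin n → Fin 3,
                Real.sqrt (∫ z : Fin 3 → ℝ,
                  ((s / hypPoint s z 0) * applyBoosts J u (hypPoint s z))^2) := by
  refine ⟨72, by norm_num, fun u hu hsupp s hs2 x => ?_⟩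
  have hs : 0 < s := by linarith
  have hu0 : ∀ y ∈ coneExterior, u y = 0 := fun y hy => by
    have := hsupp (y 0) (fun i => y i.succ) (le_of_lt hy)
    rwa [spt, show Fin.cons (y 0) (fun i => y i.succ) = y from Fin.cons_self_tail y] at this
  have ht := hypPoint_zero_pos hs x
  set t := hypPoint s x 0
  let F : (Fin 3 → ℝ) → ((Fin 4 → ℝ) → ℝ) → ℝ := fun y φ =>
    ∫ r in (0:ℝ)..1, r * |hypWeighted s φ (x + r • (t / 4) • y)|
  have hcF : ∀ {n : ℕ} (J : Fin n → Fin 3), Continuous fun y => F y (applyBoosts J u) := fun J => by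
    have := continuous_hypWeighted hs (contDiff_applyBoosts hu J).continuous
    exact intervalIntegral.continuous_parametric_intervalIntegral_of_continuous' (by fun_prop) _ _
  have hiF : ∀ {n : ℕ} (J : Fin n → Fin 3),
      IntegrableOn (fun y => F y (applyBoosts J u)) unitCube := fun J =>
    (hcF J).continuousOn.integrableOn_compact isCompact_unitCube
  have hiS : IntegrableOn (fun y => boostSum (F y) u) unitCube :=
    integrable_finsetSum _ fun n _ => integrable_finsetSum _ fun J _ => hiF J
  have hpt : ∀ y ∈ unitCube, |u (hypPoint s x)| ≤ 9 / 2 * (t / s) * boostSum (F y) u :=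
    fun y hy => abs_comp_hypPoint_le hu hs x ((t / 4) • y) fun a => by
      rw [Pi.smul_apply, smul_eq_mul, abs_mul, abs_of_pos (by positivity)]
      nlinarith [abs_le_of_mem_unitCube hy a]
  have havg : |u (hypPoint s x)| ≤ 9 / 2 * (t / s) * ∫ y in unitCube, boostSum (F y) u := by
    rw [← integral_const_mul]
    have := setIntegral_mono_on (integrable_const (μ := volume.restrict unitCube) _)
      (hiS.const_mul _) isCompact_unitCube.measurableSet hpt
    simpa using this
  have hsum : ∫ y in unitCube, boostSum (F y) u ≤ 2 * (t / 4) ^ (-(3/2) : ℝ) *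
      boostSum (fun φ => √(∫ z, hypWeighted s φ z ^ 2)) u := by
    unfold boostSum
    rw [integral_finsetSum _ fun n _ => integrable_finsetSum _ fun J _ => hiF J,
      Finset.mul_sum]
    refine Finset.sum_le_sum fun n _ => ?_
    rw [integral_finsetSum _ fun J _ => hiF J, Finset.mul_sum]
    refine Finset.sum_le_sum fun J _ => ?_
    have hc := (contDiff_applyBoosts hu J).continuous
    exact integral_unitCube_integral_le (continuous_hypWeighted hs hc)
      (integrable_hypWeighted_sq hs hc (eqOn_zero_applyBoosts hu0 J)) x (by positivity)
  change _ ≤ 72 * boostSum (fun φ => √(∫ z, hypWeighted s φ z ^ 2)) u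
  set N := boostSum (fun φ => √(∫ z, hypWeighted s φ z ^ 2)) u
  have hpow : (t / 4) ^ (-(3/2) : ℝ) = 8 * t ^ (-(3/2) : ℝ) := by
    have h4 : (4:ℝ) ^ (-(3/2) : ℝ) = 8⁻¹ := by
      rw [show (4:ℝ) = 2 ^ (2:ℝ) by norm_num, ← Real.rpow_mul (by norm_num),
        show (2:ℝ) * -(3/2) = -3 by norm_num]
      norm_num [Real.rpow_neg]
    rw [Real.div_rpow ht.le (by norm_num), h4, div_inv_eq_mul, mul_comm]
  have hone : t ^ ((1:ℝ)/2) * t * t ^ (-(3/2) : ℝ) = 1 := by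
    nth_rewrite 2 [← Real.rpow_one t]
    rw [← Real.rpow_add ht, ← Real.rpow_add ht]
    norm_num
  calc s * t ^ ((1:ℝ)/2) * |u (hypPoint s x)|
      ≤ s * t ^ ((1:ℝ)/2) * (9 / 2 * (t / s) * (2 * (t / 4) ^ (-(3/2) : ℝ) * N)) := by
        gcongr
        exact havg.trans (by gcongr)
    _ = 72 * (t ^ ((1:ℝ)/2) * t * t ^ (-(3/2) : ℝ)) * N := by
        rw [hpow]
        field_simp
        ring
    _ = 72 * N := by rw [hone, mul_one]
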